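/- There exists Y > 0 such that for every τ in the upper half-plane ℍ with Im τ > Y, setting s(τ) = −27·η(3τ)¹²/η(τ)¹², one has (3E₂(3τ) − E₂(τ))/2 = ₂F₁(1/6, 1/3; 1; −4s(τ)/(1−s(τ))²)². -/

import Mathlib

open Complex

/-- Gauss hypergeometric series `₂F₁(a,b;c;z)`. -/
noncomputable def hyp2F1 (a b c z : ℂ) : ℂ :=
  ∑' n : ℕ, ((ascPochhammer ℂ n).eval a * (ascPochhammer ℂ n).eval b) /
    ((ascPochhammer ℂ n).eval c * (n.factorial : ℂ)) * z ^ n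

/-- `q = e^{2πiτ}`. -/
noncomputable def qpar (τ : ℂ) : ℂ := Complex.exp (2 * (Real.pi : ℂ) * Complex.I * τ)

/-- Normalized Eisenstein series of weight 2: `E₂(τ) = 1 − 24 ∑_{n≥1} n qⁿ/(1−qⁿ)`. -/
noncomputable def Eis2 (τ : ℂ) : ℂ :=
  1 - 24 * ∑' n : ℕ, ((n : ℂ) + 1) * qpar τ ^ (n + 1) / (1 - qpar τ ^ (n + 1))

/-- Dedekind eta function `η(τ) = q^{1/24} ∏_{n≥1} (1 − qⁿ)`, `q^{1/24} = e^{2πiτ/24}`. -/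
noncomputable def dedekindEta (τ : ℂ) : ℂ :=
  Complex.exp (2 * (Real.pi : ℂ) * Complex.I * τ / 24) * ∏' n : ℕ, (1 - qpar τ ^ (n + 1))

section

open UpperHalfPlane hiding I
open EisensteinSeries
open Filter Asymptotics Topology
open scoped Manifold MatrixGroups ModularForm Derivative

/-- On the upper half-plane, a bound by `exp (-c * Im τ)` near `i∞` passes to the derivative of a
holomorphic function, by Cauchy's estimate. -/
lemma isBigO_normalizedDeriv {f : ℍ → ℂ} (hf : MDiff f) {c : ℝ}
    (h : f =O[atImInfty] fun τ : ℍ ↦ Real.exp (-c * τ.im)) :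
    D f =O[atImInfty] fun τ : ℍ ↦ Real.exp (-c * τ.im) := by
  obtain ⟨M, hM, hb⟩ := h.exists_pos
  rw [isBigOWith_iff, Filter.Eventually, atImInfty_mem] at hb
  obtain ⟨A, hA⟩ := hb
  refine .of_bound (‖(2 * Real.pi * I : ℂ)⁻¹‖ * (M * Real.exp |c|)) ?_
  rw [Filter.Eventually, atImInfty_mem]
  refine ⟨max A 1 + 1, fun τ hτ ↦ ?_⟩
  have hsub : ∀ z ∈ Metric.closedBall (τ : ℂ) 1, max A 1 ≤ z.im ∧ |z.im - τ.im| ≤ 1 := by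
    intro z hz
    have h1 : |(z - τ).im| ≤ 1 := (abs_im_le_norm _).trans (by simpa [Complex.dist_eq] using hz)
    simp only [sub_im, coe_im] at h1
    exact ⟨by linarith [(abs_le.mp h1).1], h1⟩
  have hpos : ∀ z ∈ Metric.closedBall (τ : ℂ) 1, 0 < z.im := fun z hz ↦ by
    linarith [(hsub z hz).1, le_max_right A 1]
  have hd : DifferentiableOn ℂ (f ∘ ofComplex) (Metric.closedBall (τ : ℂ) 1) :=
    (UpperHalfPlane.mdifferentiable_iff.mp hf).mono hpos
  have key := Complex.norm_deriv_le_of_forall_mem_sphere_norm_le (c := (τ : ℂ)) (R := 1)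
    (C := M * Real.exp |c| * Real.exp (-c * τ.im)) one_pos
    (hd.mono Metric.closure_ball_subset_closedBall).diffContOnCl (fun z hz ↦ ?_)
  · simp only [Set.mem_ofPred_eq, Derivative.normalizedDerivOfComplex, norm_mul, Real.norm_eq_abs,
      Real.abs_exp]
    calc _ ≤ ‖(2 * Real.pi * I : ℂ)⁻¹‖ * (M * Real.exp |c| * Real.exp (-c * τ.im)) := by
            rw [div_one] at key
            simpa [norm_mul] using
              mul_le_mul_of_nonneg_left key (norm_nonneg (2 * Real.pi * I : ℂ)⁻¹)
      _ = _ := by ring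
  · have hz' := Metric.sphere_subset_closedBall hz
    obtain ⟨h1, h2⟩ := hsub z hz'
    have h3 := hA ⟨z, hpos z hz'⟩ ((le_max_left _ _).trans h1)
    simp only [Set.mem_ofPred_eq, Real.norm_eq_abs, Real.abs_exp] at h3
    simp only [Function.comp_apply, ofComplex_apply_of_im_pos (hpos z hz')]
    refine h3.trans ?_
    rw [mul_assoc, ← Real.exp_add]
    refine mul_le_mul_of_nonneg_left (Real.exp_le_exp.mpr ?_) hM.le
    change -c * z.im ≤ _
    have h4 : |c * (z.im - τ.im)| ≤ |c| * 1 := by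
      rw [abs_mul]; exact mul_le_mul_of_nonneg_left h2 (abs_nonneg c)
    linarith [neg_le_of_abs_le h4]

lemma isBoundedAtImInfty_normalizedDeriv {f : ℍ → ℂ} (hf : MDiff f) (h : IsBoundedAtImInfty f) :
    IsBoundedAtImInfty (D f) := by
  have := isBigO_normalizedDeriv (c := 0) hf
  simp only [neg_zero, zero_mul, Real.exp_zero] at this
  exact this h

/-- A weight `k` modular form `f` for `Γ₀(3)`, together with its expansion `g = f ∣ S` at the
cusp `0`. -/
structure IsLevelThreePair (k : ℤ) (f g : ℍ → ℂ) : Prop where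
  mdiff : MDiff f
  mdiff' : MDiff g
  bdd : IsBoundedAtImInfty f
  bdd' : IsBoundedAtImInfty g
  slash_T : f ∣[k] ModularGroup.T = f
  slash_S : f ∣[k] ModularGroup.S = g
  slash_T_pow : g ∣[k] (ModularGroup.T ^ 3) = g

namespace IsLevelThreePair

variable {k l : ℤ} {f g f₁ g₁ f₂ g₂ : ℍ → ℂ}

lemma add (h₁ : IsLevelThreePair k f₁ g₁) (h₂ : IsLevelThreePair k f₂ g₂) :
    IsLevelThreePair k (f₁ + f₂) (g₁ + g₂) where
  mdiff := h₁.mdiff.add h₂.mdiff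
  mdiff' := h₁.mdiff'.add h₂.mdiff'
  bdd := h₁.bdd.add h₂.bdd
  bdd' := h₁.bdd'.add h₂.bdd'
  slash_T := by rw [SlashAction.add_slash, h₁.slash_T, h₂.slash_T]
  slash_S := by rw [SlashAction.add_slash, h₁.slash_S, h₂.slash_S]
  slash_T_pow := by rw [SlashAction.add_slash, h₁.slash_T_pow, h₂.slash_T_pow]

lemma smul (c : ℂ) (h : IsLevelThreePair k f g) : IsLevelThreePair k (c • f) (c • g) where
  mdiff := h.mdiff.const_smul c
  mdiff' := h.mdiff'.const_smul c
  bdd := h.bdd.const_smul_left c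
  bdd' := h.bdd'.const_smul_left c
  slash_T := by rw [ModularForm.SL_smul_slash, h.slash_T]
  slash_S := by rw [ModularForm.SL_smul_slash, h.slash_S]
  slash_T_pow := by rw [ModularForm.SL_smul_slash, h.slash_T_pow]

lemma mul (h₁ : IsLevelThreePair k f₁ g₁) (h₂ : IsLevelThreePair l f₂ g₂) :
    IsLevelThreePair (k + l) (f₁ * f₂) (g₁ * g₂) where
  mdiff := h₁.mdiff.mul h₂.mdiff
  mdiff' := h₁.mdiff'.mul h₂.mdiff'
  bdd := h₁.bdd.mul h₂.bdd
  bdd' := h₁.bdd'.mul h₂.bdd'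
  slash_T := by rw [ModularForm.mul_slash_SL2, h₁.slash_T, h₂.slash_T]
  slash_S := by rw [ModularForm.mul_slash_SL2, h₁.slash_S, h₂.slash_S]
  slash_T_pow := by rw [ModularForm.mul_slash_SL2, h₁.slash_T_pow, h₂.slash_T_pow]

lemma isBounded_serreDerivative {f : ℍ → ℂ} (k : ℂ) (hf : MDiff f) (h : IsBoundedAtImInfty f) :
    IsBoundedAtImInfty (Derivative.serreDerivative k f) := by
  have h2 : IsBoundedAtImInfty ((k * 12⁻¹) • (EisensteinSeries.E2 * f)) :=
    (EisensteinSeries.isBoundedAtImInfty_E2.mul h).const_smul_left _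
  have h3 := (isBoundedAtImInfty_normalizedDeriv hf h).add h2.neg_left
  convert! h3 using 1
  ext τ
  simp [Derivative.serreDerivative]
  ring

lemma serreDerivative (h : IsLevelThreePair k f g) :
    IsLevelThreePair (k + 2) (Derivative.serreDerivative k f) (Derivative.serreDerivative k g) where
  mdiff := Derivative.serreDerivative_mdifferentiable _ h.mdiff
  mdiff' := Derivative.serreDerivative_mdifferentiable _ h.mdiff'
  bdd := isBounded_serreDerivative _ h.mdiff h.bdd
  bdd' := isBounded_serreDerivative _ h.mdiff' h.bdd'
  slash_T := by rw [Derivative.serreDerivative_slash_equivariant h.mdiff, h.slash_T]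
  slash_S := by rw [Derivative.serreDerivative_slash_equivariant h.mdiff, h.slash_S]
  slash_T_pow := by rw [Derivative.serreDerivative_slash_equivariant h.mdiff', h.slash_T_pow]

end IsLevelThreePair

/-- The valence bound in level one, for functions on `ℍ`: vanishing to order more than `w / 12`
at `i∞` forces a level-one form of weight `w` to vanish. -/
lemma eq_zero_of_levelOne (m : ℕ) {w : ℤ} {N : ℍ → ℂ} (hN : MDiff N)
    (hS : N ∣[w] ModularGroup.S = N) (hT : N ∣[w] ModularGroup.T = N)
    (hO : N =O[atImInfty] fun τ : ℍ ↦ Real.exp (-(2 * Real.pi * m) * τ.im))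
    (hw : w < 12 * m) : N = 0 := by
  induction m generalizing w N with
  | zero =>
    have hb : IsBoundedAtImInfty N := hO.congr_right fun τ ↦ by simp
    let F : ModularForm 𝒮ℒ w :=
      { toFun := N
        slash_action_eq' := by
          rintro A ⟨A, rfl⟩
          exact SlashInvariantForm.slash_action_generators_SL2Z hS hT A
        holo' := hN
        bdd_at_cusps' := by
          intro c hc
          rw [Subgroup.IsArithmetic.isCusp_iff_isCusp_SL2Z] at hc
          rw [OnePoint.isBoundedAt_iff_forall_SL2Z hc]
          intro γ _
          rw [SlashInvariantForm.slash_action_generators_SL2Z hS hT]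
          exact hb }
    exact ModularFormClass.levelOne_neg_weight_eq_zero (by simpa using hw) F
  | succ m ih =>
    have hΔ : MDiff ModularForm.discriminant := CuspForm.discriminant.holo'
    have h0 : N / ModularForm.discriminant = 0 := by
      refine ih (w := w - 12) (fun τ ↦ mdifferentiableAt_iff.mpr
        ((mdifferentiableAt_iff.mp (hN τ)).div (mdifferentiableAt_iff.mp (hΔ τ))
          (by simpa using ModularForm.discriminant_ne_zero τ)))
        ?_ ?_ ?_ (by push_cast at hw; linarith)
      · rw [ModularForm.div_slash_SL2, hS, ModularForm.discriminant_S_invariant]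
      · rw [ModularForm.div_slash_SL2, hT, ModularForm.discriminant_T_invariant]
      · have h1 := ModularForm.exp_isBigO_discriminant.inv_rev
          (.of_forall fun τ h ↦ absurd h (Real.exp_pos _).ne')
        refine (hO.mul h1).congr_right fun τ ↦ ?_
        rw [← Real.exp_neg, ← Real.exp_add]
        push_cast
        ring_nf
    ext τ
    have := congrFun h0 τ
    simpa [ModularForm.discriminant_ne_zero τ] using this

namespace IsLevelThreePair

variable {k : ℤ} {f g : ℍ → ℂ}

lemma slash_neg_one (hk : Even k) (f : ℍ → ℂ) : f ∣[k] (-1 : SL(2, ℤ)) = f := by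
  ext τ
  simp [ModularForm.SL_slash_apply, denom, hk.neg.neg_one_zpow]

/-- A valence bound for `Γ₀(3)`: the norm of `f` to level one vanishes at `i∞` at least to the
order of `f`. -/
theorem eq_zero (h : IsLevelThreePair k f g) (hk : Even k) (m : ℕ) (hm : k < 3 * m)
    (hO : f =O[atImInfty] fun τ : ℍ ↦ Real.exp (-(2 * Real.pi * m) * τ.im)) : f = 0 := by
  set S := ModularGroup.S
  set T := ModularGroup.T
  have hSS : S * S = -1 := by decide
  have hSTS : S * T * S = T⁻¹ * S * T⁻¹ := by decide
  have hfT' : f ∣[k] T⁻¹ = f := by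
    conv_lhs => rw [← h.slash_T]
    rw [← SlashAction.slash_mul, mul_inv_cancel, SlashAction.slash_one]
  have hgT' : g ∣[k] T⁻¹ = (g ∣[k] T) ∣[k] T := by
    conv_lhs => rw [← h.slash_T_pow]
    rw [← SlashAction.slash_mul, ← SlashAction.slash_mul]
    exact congrArg (g ∣[k] ·) (by rw [pow_succ, mul_inv_cancel_right, sq] : T ^ 3 * T⁻¹ = T * T)
  have hgS : g ∣[k] S = f := by
    rw [← h.slash_S, ← SlashAction.slash_mul, hSS, slash_neg_one hk]
  have hgTS : (g ∣[k] T) ∣[k] S = (g ∣[k] T) ∣[k] T := by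
    rw [← hgT', ← h.slash_S, ← SlashAction.slash_mul, ← SlashAction.slash_mul, ← mul_assoc, hSTS,
      SlashAction.slash_mul, SlashAction.slash_mul, hfT']
  have hgTTS : ((g ∣[k] T) ∣[k] T) ∣[k] S = g ∣[k] T := by
    rw [← hgTS, ← SlashAction.slash_mul, hSS, slash_neg_one hk]
  have hgTTT : ((g ∣[k] T) ∣[k] T) ∣[k] T = g := by
    conv_rhs => rw [← h.slash_T_pow]
    rw [← SlashAction.slash_mul, ← SlashAction.slash_mul]
    rfl
  have hmd : ∀ {φ : ℍ → ℂ}, MDiff φ → MDiff (φ ∣[k] T) := fun hφ ↦ hφ.slash k _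
  have hbd : ∀ {φ : ℍ → ℂ}, IsBoundedAtImInfty φ → IsBoundedAtImInfty (φ ∣[k] T) := fun hφ ↦
    IsBoundedAtImInfty.slash k
      (by simp [T, Matrix.SpecialLinearGroup.mapGL_coe_matrix, ModularGroup.coe_T]) hφ
  have hN : f * g * (g ∣[k] T * (g ∣[k] T) ∣[k] T) = 0 := by
    refine eq_zero_of_levelOne m (w := k + k + (k + k))
      ((h.mdiff.mul h.mdiff').mul ((hmd h.mdiff').mul (hmd (hmd h.mdiff')))) ?_ ?_ ?_ (by linarith)
    · rw [ModularForm.mul_slash_SL2, ModularForm.mul_slash_SL2, ModularForm.mul_slash_SL2,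
        h.slash_S, hgS, hgTS, hgTTS]
      ring
    · rw [ModularForm.mul_slash_SL2, ModularForm.mul_slash_SL2, ModularForm.mul_slash_SL2,
        h.slash_T, hgTTT]
      ring
    · exact ((hO.mul h.bdd').mul ((hbd h.bdd').mul (hbd (hbd h.bdd')))).congr_right fun τ ↦ by simp
  have hg : g = 0 → f = 0 := fun hg ↦ (SlashAction.slash_eq_zero_iff k S f).mp (h.slash_S.trans hg)
  rw [UpperHalfPlane.mul_eq_zero_iff (h.mdiff.mul h.mdiff')
      ((hmd h.mdiff').mul (hmd (hmd h.mdiff'))),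
    UpperHalfPlane.mul_eq_zero_iff h.mdiff h.mdiff',
    UpperHalfPlane.mul_eq_zero_iff (hmd h.mdiff') (hmd (hmd h.mdiff'))] at hN
  simp only [SlashAction.slash_eq_zero_iff] at hN
  tauto

end IsLevelThreePair

lemma qpar_ne_zero (z : ℂ) : qpar z ≠ 0 := Complex.exp_ne_zero _

lemma norm_qpar (z : ℂ) : ‖qpar z‖ = Real.exp (-(2 * Real.pi) * z.im) := by
  rw [qpar, Complex.norm_exp]
  congr 1
  simp

lemma norm_exp_eq_norm_qpar_pow (n : ℕ) (τ : ℍ) :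
    ‖Real.exp (-(2 * Real.pi * n) * τ.im)‖ = ‖qpar τ ^ n‖ := by
  rw [norm_pow, norm_qpar, ← Real.exp_nat_mul, coe_im, Real.norm_eq_abs, Real.abs_exp]
  ring_nf

lemma isBigO_qpar_pow (n : ℕ) : (fun τ : ℍ ↦ qpar τ ^ n) =O[atImInfty]
    fun τ : ℍ ↦ Real.exp (-(2 * Real.pi * n) * τ.im) :=
  isBigO_of_le _ fun τ ↦ (norm_exp_eq_norm_qpar_pow n τ).ge

lemma tendsto_qpar : Tendsto (fun τ : ℍ ↦ qpar τ) atImInfty (𝓝 0) := by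
  simpa [Function.Periodic.qParam, qpar] using qParam_tendsto_atImInfty one_pos

lemma hasDerivAt_qpar (z : ℂ) : HasDerivAt qpar (2 * Real.pi * I * qpar z) z := by
  have := ((hasDerivAt_id z).const_mul (2 * (Real.pi : ℂ) * I)).cexp
  rw [mul_one] at this
  exact this.congr_deriv (mul_comm _ _)

lemma mdiff_qpar : MDiff (fun τ : ℍ ↦ qpar τ) := fun τ ↦ by
  rw [mdifferentiableAt_iff]
  refine (hasDerivAt_qpar τ).differentiableAt.congr_of_eventuallyEq ?_
  filter_upwards [isOpen_upperHalfPlaneSet.mem_nhds τ.im_pos] with w hw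
  simp [ofComplex_apply_of_im_pos hw]

lemma normalizedDeriv_qpar : D (fun τ : ℍ ↦ qpar τ) = fun τ : ℍ ↦ qpar τ := by
  ext τ
  have h : (fun τ : ℍ ↦ qpar τ) ∘ ofComplex =ᶠ[𝓝 (τ : ℂ)] qpar := by
    filter_upwards [isOpen_upperHalfPlaneSet.mem_nhds τ.im_pos] with w hw
    simp [ofComplex_apply_of_im_pos hw]
  rw [Derivative.normalizedDerivOfComplex, h.deriv_eq, (hasDerivAt_qpar τ).deriv,
    inv_mul_cancel_left₀ two_pi_I_ne_zero]

/-- `f` is holomorphic on `ℍ` and `f = c₀ + c₁ q + c₂ q² + O(q³)` at `i∞`. -/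
structure HasJet (f : ℍ → ℂ) (c₀ c₁ c₂ : ℂ) : Prop where
  mdiff : MDiff f
  isBigO : (fun τ : ℍ ↦ f τ - (c₀ + c₁ * qpar τ + c₂ * qpar τ ^ 2)) =O[atImInfty]
    fun τ : ℍ ↦ Real.exp (-(2 * Real.pi * (3 : ℕ)) * τ.im)

namespace HasJet

variable {f g : ℍ → ℂ} {a₀ a₁ a₂ b₀ b₁ b₂ : ℂ}

lemma add (hf : HasJet f a₀ a₁ a₂) (hg : HasJet g b₀ b₁ b₂) :
    HasJet (f + g) (a₀ + b₀) (a₁ + b₁) (a₂ + b₂) where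
  mdiff := hf.mdiff.add hg.mdiff
  isBigO := (hf.isBigO.add hg.isBigO).congr_left fun τ ↦ by simp only [Pi.add_apply]; ring

lemma smul (c : ℂ) (hf : HasJet f a₀ a₁ a₂) : HasJet (c • f) (c * a₀) (c * a₁) (c * a₂) where
  mdiff := hf.mdiff.const_smul c
  isBigO := (hf.isBigO.const_mul_left c).congr_left fun τ ↦ by
    simp only [Pi.smul_apply, smul_eq_mul]; ring

lemma sub (hf : HasJet f a₀ a₁ a₂) (hg : HasJet g b₀ b₁ b₂) :
    HasJet (f - g) (a₀ - b₀) (a₁ - b₁) (a₂ - b₂) where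
  mdiff := hf.mdiff.sub hg.mdiff
  isBigO := (hf.isBigO.sub hg.isBigO).congr_left fun τ ↦ by simp only [Pi.sub_apply]; ring

lemma tendsto (hf : HasJet f a₀ a₁ a₂) : Tendsto f atImInfty (𝓝 a₀) := by
  have h3 : Tendsto (fun τ : ℍ ↦ Real.exp (-(2 * Real.pi * (3 : ℕ)) * τ.im)) atImInfty (𝓝 0) := by
    have := (tendsto_qpar.norm.pow 3)
    simp only [norm_zero, ne_eq, OfNat.ofNat_ne_zero, not_false_eq_true, zero_pow] at this
    refine this.congr fun τ ↦ ?_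
    rw [← norm_pow, ← norm_exp_eq_norm_qpar_pow, Real.norm_eq_abs, Real.abs_exp]
  have h := (hf.isBigO.trans_tendsto h3).add
    ((tendsto_const_nhds (x := a₀)).add ((tendsto_qpar.const_mul a₁).add
      ((tendsto_qpar.pow 2).const_mul a₂)))
  simp only [mul_zero, ne_eq, OfNat.ofNat_ne_zero, not_false_eq_true, zero_pow, add_zero,
    zero_add] at h
  exact h.congr fun τ ↦ by ring

lemma isBoundedAtImInfty (hf : HasJet f a₀ a₁ a₂) : IsBoundedAtImInfty f :=
  hf.tendsto.isBigO_one ℝ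

lemma mul (hf : HasJet f a₀ a₁ a₂) (hg : HasJet g b₀ b₁ b₂) :
    HasJet (f * g) (a₀ * b₀) (a₀ * b₁ + a₁ * b₀) (a₀ * b₂ + a₁ * b₁ + a₂ * b₀) where
  mdiff := hf.mdiff.mul hg.mdiff
  isBigO := by
    have h1 := hf.isBigO.mul hg.isBoundedAtImInfty
    have hp : (fun τ : ℍ ↦ a₀ + a₁ * qpar τ + a₂ * qpar τ ^ 2) =O[atImInfty] (1 : ℍ → ℝ) :=
      (((tendsto_const_nhds (x := a₀)).add (tendsto_qpar.const_mul a₁)).add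
        ((tendsto_qpar.pow 2).const_mul a₂)).isBigO_one ℝ
    have hp' : (fun τ : ℍ ↦ (a₁ * b₂ + a₂ * b₁) + a₂ * b₂ * qpar τ) =O[atImInfty] (1 : ℍ → ℝ) :=
      (((tendsto_const_nhds (x := a₁ * b₂ + a₂ * b₁)).add
        (tendsto_qpar.const_mul (a₂ * b₂)))).isBigO_one ℝ
    have h2 := hg.isBigO.mul hp
    have h3 := (isBigO_qpar_pow 3).mul hp'
    simp only [Pi.one_apply, mul_one] at h1 h2 h3
    refine ((h1.add h2).add h3).congr_left fun τ ↦ ?_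
    simp only [Pi.mul_apply]
    ring

lemma normalizedDeriv (hf : HasJet f a₀ a₁ a₂) : HasJet (D f) 0 a₁ (2 * a₂) where
  mdiff := Derivative.normalizedDerivOfComplex_mdifferentiable hf.mdiff
  isBigO := by
    have hq : MDiff (a₁ • (fun τ : ℍ ↦ qpar τ)) := mdiff_qpar.const_smul _
    have hq2 : MDiff (a₂ • (fun τ : ℍ ↦ qpar τ) ^ 2) := (mdiff_qpar.pow 2).const_smul _
    have hp :
        MDiff ((fun _ : ℍ ↦ a₀) + a₁ • (fun τ : ℍ ↦ qpar τ) + a₂ • (fun τ : ℍ ↦ qpar τ) ^ 2) :=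
      (mdifferentiable_const.add hq).add hq2
    have := isBigO_normalizedDeriv (hf.mdiff.sub hp) hf.isBigO
    refine this.congr_left fun τ ↦ ?_
    rw [Derivative.normalizedDerivOfComplex_sub _ _ hf.mdiff hp,
      Derivative.normalizedDerivOfComplex_add _ _ (mdifferentiable_const.add hq) hq2,
      Derivative.normalizedDerivOfComplex_add _ _ mdifferentiable_const hq,
      Derivative.normalizedDerivOfComplex_smul _ _ mdiff_qpar,
      Derivative.normalizedDerivOfComplex_smul _ _ (mdiff_qpar.pow 2),
      Derivative.normalizedDerivOfComplex_pow _ _ mdiff_qpar,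
      Derivative.normalizedDerivOfComplex_const, normalizedDeriv_qpar]
    simp
    ring

lemma tendsto_div_qpar (hf : HasJet f 0 a₁ a₂) :
    Tendsto (fun τ : ℍ ↦ f τ / qpar τ) atImInfty (𝓝 a₁) := by
  have h3 : Tendsto (fun τ : ℍ ↦ (f τ - (0 + a₁ * qpar τ + a₂ * qpar τ ^ 2)) / qpar τ)
      atImInfty (𝓝 0) := by
    have hO : (fun τ : ℍ ↦ f τ - (0 + a₁ * qpar τ + a₂ * qpar τ ^ 2)) =O[atImInfty]
        fun τ : ℍ ↦ qpar τ ^ 3 := by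
      exact hf.isBigO.trans (isBigO_of_le _ fun τ ↦ (norm_exp_eq_norm_qpar_pow 3 τ).le)
    have := hO.mul (isBigO_refl (fun τ : ℍ ↦ (qpar τ)⁻¹) atImInfty)
    refine (this.trans_tendsto (((tendsto_qpar.pow 2).congr fun τ ↦ ?_).trans (by simp)))
    field_simp [qpar_ne_zero τ]
  have h := h3.add ((tendsto_const_nhds (x := a₁)).add (tendsto_qpar.const_mul a₂))
  simp only [mul_zero, add_zero, zero_add] at h
  refine h.congr fun τ ↦ ?_
  field_simp [qpar_ne_zero τ]
  ring

lemma isBigO_two (hf : HasJet f 0 0 a₂) :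
    f =O[atImInfty] fun τ : ℍ ↦ Real.exp (-(2 * Real.pi * (2 : ℕ)) * τ.im) := by
  have h1 : (fun τ : ℍ ↦ Real.exp (-(2 * Real.pi * (3 : ℕ)) * τ.im)) =O[atImInfty]
      fun τ : ℍ ↦ Real.exp (-(2 * Real.pi * (2 : ℕ)) * τ.im) := by
    refine isBigO_of_le _ fun τ ↦ ?_
    rw [Real.norm_eq_abs, Real.norm_eq_abs, Real.abs_exp, Real.abs_exp, Real.exp_le_exp]
    push_cast
    nlinarith [mul_pos Real.pi_pos τ.im_pos]
  refine ((hf.isBigO.trans h1).add ((isBigO_qpar_pow 2).const_mul_left a₂)).congr_left fun τ ↦ ?_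
  ring

end HasJet

lemma hasJet_E2 : HasJet E2 1 (-24) (-72) where
  mdiff := E2_mdifferentiable
  isBigO := by
    set a : ℕ → ℂ := fun m ↦ if m = 0 then 1 else -24 * ArithmeticFunction.sigma 1 m with ha
    have hE (τ : ℍ) : HasSum (fun m ↦ a m • qpar τ ^ m) (E2 τ) := hasSum_qExpansion_E2 τ
    have hs1 : ArithmeticFunction.sigma 1 1 = 1 := by decide
    have hs2 : ArithmeticFunction.sigma 1 2 = 3 := by decide
    have hr : IsBoundedAtImInfty
        fun τ : ℍ ↦ (E2 τ - (1 + -24 * qpar τ + -72 * qpar τ ^ 2)) / qpar τ ^ 3 := by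
      refine isBoundedAtImInfty_of_hasSum_qExpansion (c := fun m ↦ a (m + 3)) one_pos fun τ ↦ ?_
      have h := ((hasSum_nat_add_iff' 3).mpr (hE τ)).div_const (qpar τ ^ 3)
      convert! h using 1
      · ext m
        have : Function.Periodic.qParam 1 τ = qpar τ := by simp [Function.Periodic.qParam, qpar]
        rw [this, pow_add, smul_eq_mul, smul_eq_mul, ← mul_assoc,
          mul_div_cancel_right₀ _ (pow_ne_zero 3 (qpar_ne_zero τ))]
      · simp [Finset.sum_range_succ, ha, hs1, hs2]
        ring
    refine ((isBigO_qpar_pow 3).mul hr).congr (fun τ ↦ ?_) fun τ ↦ by simp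
    rw [mul_div_cancel₀ _ (pow_ne_zero 3 (qpar_ne_zero τ))]

/-- Rescaling of the argument of a function on `ℍ` by a real number, meant to be positive. -/
noncomputable def scaleArg (c : ℝ) (f : ℍ → ℂ) (τ : ℍ) : ℂ := f (ofComplex (c * τ))

section scaleArg

variable {c : ℝ} {f : ℍ → ℂ}

lemma im_ofComplex_mul (hc : 0 < c) (τ : ℍ) : (ofComplex (c * τ)).im = c * τ.im := by
  have : 0 < (c * τ : ℂ).im := by simpa using mul_pos hc τ.im_pos
  rw [ofComplex_apply_of_im_pos this]
  change (c * τ : ℂ).im = _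
  simp

lemma mdiff_scaleArg (hc : 0 < c) (hf : MDiff f) : MDiff (scaleArg c f) := by
  rw [UpperHalfPlane.mdifferentiable_iff] at hf ⊢
  have hm : Set.MapsTo (fun z : ℂ ↦ c * z) {z | 0 < z.im} {z | 0 < z.im} := fun z hz ↦ by
    simpa using mul_pos hc hz
  refine (hf.comp (differentiableOn_id.const_mul (c : ℂ)) hm).congr fun z hz ↦ ?_
  simp [scaleArg, ofComplex_apply_of_im_pos hz]

lemma tendsto_ofComplex_mul (hc : 0 < c) :
    Tendsto (fun τ : ℍ ↦ ofComplex (c * τ)) atImInfty atImInfty := by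
  simp only [atImInfty, tendsto_comap_iff]
  exact (tendsto_comap.const_mul_atTop hc).congr fun τ ↦ (im_ofComplex_mul hc τ).symm

lemma isBoundedAtImInfty_scaleArg (hc : 0 < c) (hf : IsBoundedAtImInfty f) :
    IsBoundedAtImInfty (scaleArg c f) :=
  hf.comp_tendsto (tendsto_ofComplex_mul hc)

end scaleArg

lemma hasJet_scaleArg_E2 : HasJet (scaleArg 3 E2) 1 0 0 where
  mdiff := mdiff_scaleArg three_pos E2_mdifferentiable
  isBigO := by
    have h1 : (fun τ : ℍ ↦ E2 τ - 1) =O[atImInfty] fun τ : ℍ ↦ qpar τ := by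
      have h2 := (hasJet_E2.sub (b₀ := 1) (b₁ := 0) (b₂ := 0) (g := fun _ ↦ 1)
        ⟨mdifferentiable_const, by simpa using isBigO_zero _ _⟩)
      rw [sub_self] at h2
      have h3 := (h2.tendsto_div_qpar.isBigO_one ℝ).mul
        (isBigO_refl (fun τ : ℍ ↦ qpar τ) atImInfty).norm_right
      refine (h3.congr_left fun τ ↦ ?_).trans (isBigO_of_le _ fun τ ↦ by simp)
      simp [div_mul_cancel₀ _ (qpar_ne_zero τ)]
    have h4 := h1.comp_tendsto (tendsto_ofComplex_mul three_pos)
    refine (h4.congr_left fun τ ↦ ?_).trans (isBigO_of_le _ fun τ ↦ le_of_eq ?_)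
    · simp [scaleArg]
    · rw [norm_exp_eq_norm_qpar_pow, norm_pow, norm_qpar, ← Real.exp_nat_mul]
      simp only [Function.comp_apply, norm_qpar, coe_im, im_ofComplex_mul three_pos]
      push_cast
      ring_nf

lemma slash_T_apply (k : ℤ) (f : ℍ → ℂ) (τ : ℍ) :
    (f ∣[k] ModularGroup.T) τ = f ((1 : ℝ) +ᵥ τ) := by
  rw [ModularForm.SL_slash_apply, modular_T_smul]
  simp [denom, ModularGroup.coe_T]

lemma slash_S_apply (k : ℤ) (f : ℍ → ℂ) (τ : ℍ) :
    (f ∣[k] ModularGroup.S) τ = f (ModularGroup.S • τ) * (τ : ℂ) ^ (-k) := by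
  rw [ModularForm.SL_slash_apply]
  simp [denom, ModularGroup.coe_S]

lemma E2_vadd (τ : ℍ) : E2 ((1 : ℝ) +ᵥ τ) = E2 τ := by
  have := congrFun (E2_slash_action ModularGroup.T) τ
  rw [slash_T_apply] at this
  simpa [D2_T] using this

lemma E2_S (τ : ℍ) : E2 (ModularGroup.S • τ) = τ ^ 2 * E2 τ + 6 * τ / (Real.pi * I) := by
  have := congrFun (E2_slash_action ModularGroup.S) τ
  rw [slash_S_apply] at this
  have hτ := ne_zero τ
  have hπ : (Real.pi : ℂ) ≠ 0 := by exact_mod_cast Real.pi_ne_zero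
  simp only [Pi.sub_apply, Pi.smul_apply, D2_S, riemannZeta_two, smul_eq_mul] at this
  rw [zpow_neg, mul_inv_eq_iff_eq_mul₀ (zpow_ne_zero _ hτ)] at this
  rw [this]
  field_simp
  linear_combination (-6) * I_sq

lemma E2_ofComplex_add_one {z : ℂ} (hz : 0 < z.im) :
    E2 (ofComplex (z + 1)) = E2 (ofComplex z) := by
  have hz' : 0 < (z + 1).im := by simpa using hz
  rw [ofComplex_apply_of_im_pos hz, ofComplex_apply_of_im_pos hz', ← E2_vadd ⟨z, hz⟩]
  congr 1
  ext
  simp [add_comm]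

lemma E2_ofComplex_neg_inv {z : ℂ} (hz : 0 < z.im) :
    E2 (ofComplex (-z⁻¹)) = z ^ 2 * E2 (ofComplex z) + 6 * z / (Real.pi * I) := by
  have h := E2_S ⟨z, hz⟩
  rw [modular_S_smul] at h
  rw [ofComplex_apply_of_im_pos hz]
  convert h using 2
  rw [ofComplex_apply_of_im_pos (z := -z⁻¹)
    (by simpa [inv_neg] using im_inv_neg_coe_pos ⟨z, hz⟩)]
  simp [inv_neg]

/-- The weight two Eisenstein series `(3 E₂(3τ) - E₂(τ)) / 2` for `Γ₀(3)`. -/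
noncomputable def E2Three : ℍ → ℂ := (3 / 2 : ℂ) • scaleArg 3 E2 - (1 / 2 : ℂ) • E2

lemma hasJet_E2Three : HasJet E2Three 1 12 36 := by
  have := (hasJet_scaleArg_E2.smul (3 / 2)).sub (hasJet_E2.smul (1 / 2))
  norm_num at this
  exact this

lemma isLevelThreePair_E2Three :
    IsLevelThreePair 2 E2Three ((1 / 6 : ℂ) • scaleArg 3⁻¹ E2 - (1 / 2 : ℂ) • E2) where
  mdiff := hasJet_E2Three.mdiff
  mdiff' := ((mdiff_scaleArg (by norm_num) E2_mdifferentiable).const_smul _).sub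
    (E2_mdifferentiable.const_smul _)
  bdd := hasJet_E2Three.isBoundedAtImInfty
  bdd' := by
    have h1 : IsBoundedAtImInfty ((1 / 6 : ℂ) • scaleArg 3⁻¹ E2) :=
      (isBoundedAtImInfty_scaleArg (by norm_num) isBoundedAtImInfty_E2).const_smul_left _
    have h2 : IsBoundedAtImInfty ((1 / 2 : ℂ) • E2) := isBoundedAtImInfty_E2.const_smul_left _
    exact IsBigO.sub h1 h2
  slash_T := by
    ext τ
    have h : 0 < (3 * τ : ℂ).im := by simpa using τ.im_pos
    have h3 : E2 (ofComplex (3 * (1 + τ))) = E2 (ofComplex (3 * τ)) := by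
      rw [show (3 * (1 + τ) : ℂ) = 3 * τ + 1 + 1 + 1 by ring,
        E2_ofComplex_add_one (by simpa using h), E2_ofComplex_add_one (by simpa using h),
        E2_ofComplex_add_one h]
    simp only [slash_T_apply, E2Three, Pi.sub_apply, Pi.smul_apply, scaleArg, E2_vadd, coe_vadd]
    push_cast
    rw [h3]
  slash_S := by
    ext τ
    have hτ := ne_zero τ
    have h : 0 < (3⁻¹ * τ : ℂ).im := by
      simpa [← ofReal_ofNat, ← ofReal_inv] using τ.im_pos
    have h3 : (3 * (ModularGroup.S • τ : ℍ) : ℂ) = -(3⁻¹ * τ : ℂ)⁻¹ := by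
      rw [modular_S_smul]
      simp
      field_simp
    simp only [slash_S_apply, E2Three, Pi.sub_apply, Pi.smul_apply, scaleArg, E2_S, smul_eq_mul,
      zpow_neg]
    push_cast
    rw [h3, E2_ofComplex_neg_inv h]
    field_simp
    norm_cast
    field_simp
    ring
  slash_T_pow := by
    ext τ
    have h : 0 < (3⁻¹ * τ : ℂ).im := by
      simpa [← ofReal_ofNat, ← ofReal_inv] using τ.im_pos
    have h3 : E2 (ofComplex (3⁻¹ * (1 + (1 + (1 + τ))))) = E2 (ofComplex (3⁻¹ * τ)) := by
      rw [show (3⁻¹ * (1 + (1 + (1 + τ))) : ℂ) = 3⁻¹ * τ + 1 by ring, E2_ofComplex_add_one h]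
    rw [show ModularGroup.T ^ 3 = ModularGroup.T * ModularGroup.T * ModularGroup.T from
        pow_three' _,
      SlashAction.slash_mul, SlashAction.slash_mul]
    simp only [slash_T_apply, Pi.sub_apply, Pi.smul_apply, scaleArg, E2_vadd, coe_vadd]
    push_cast
    rw [h3]

lemma normalizedDeriv_coe_inv (c : ℂ) :
    D (fun τ : ℍ ↦ c * (τ : ℂ)⁻¹) = fun τ : ℍ ↦ -(2 * Real.pi * I)⁻¹ * c * ((τ : ℂ) ^ 2)⁻¹ := by
  ext τ
  have h : (fun τ : ℍ ↦ c * (τ : ℂ)⁻¹) ∘ ofComplex =ᶠ[𝓝 (τ : ℂ)] fun z ↦ c * z⁻¹ := by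
    filter_upwards [isOpen_upperHalfPlaneSet.mem_nhds τ.im_pos] with w hw
    simp [ofComplex_apply_of_im_pos hw]
  rw [Derivative.normalizedDerivOfComplex, h.deriv_eq,
    ((hasDerivAt_inv (ne_zero τ)).const_mul c).deriv]
  ring

lemma mdiff_coe_inv (c : ℂ) : MDiff (fun τ : ℍ ↦ c * (τ : ℂ)⁻¹) := fun τ ↦ by
  rw [mdifferentiableAt_iff]
  refine ((differentiableAt_inv (ne_zero τ)).const_mul c).congr_of_eventuallyEq ?_
  filter_upwards [isOpen_upperHalfPlaneSet.mem_nhds τ.im_pos] with w hw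
  simp [ofComplex_apply_of_im_pos hw]

lemma serreDerivative_one_E2_slash_T :
    Derivative.serreDerivative 1 E2 ∣[(2 : ℤ) + 2] ModularGroup.T =
      Derivative.serreDerivative 1 E2 := by
  have hE : E2 ∣[(2 : ℤ)] ModularGroup.T = E2 := by
    ext τ; rw [slash_T_apply, E2_vadd]
  have hD := Derivative.normalizedDerivOfComplex_SL_slash (k := 2) (γ := ModularGroup.T)
    E2_mdifferentiable
  rw [hE] at hD
  ext τ
  have hτ := congrFun hD τ
  simp only [Pi.sub_apply, slash_T_apply, ModularGroup.coe_T] at hτ ⊢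
  simp only [Derivative.serreDerivative, E2_vadd, hτ]
  simp

lemma serreDerivative_one_E2_slash_S :
    Derivative.serreDerivative 1 E2 ∣[(2 : ℤ) + 2] ModularGroup.S =
      Derivative.serreDerivative 1 E2 := by
  have hE : E2 ∣[(2 : ℤ)] ModularGroup.S =
      E2 + fun τ : ℍ ↦ 6 / (Real.pi * I) * (τ : ℂ)⁻¹ := by
    ext τ
    have hτ := ne_zero τ
    rw [slash_S_apply, E2_S]
    simp only [Pi.add_apply, zpow_neg]
    norm_cast
    field_simp
  have hD := Derivative.normalizedDerivOfComplex_SL_slash (k := 2) (γ := ModularGroup.S)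
    E2_mdifferentiable
  rw [hE, Derivative.normalizedDerivOfComplex_add _ _ E2_mdifferentiable (mdiff_coe_inv _),
    normalizedDeriv_coe_inv] at hD
  ext τ
  have hτ := ne_zero τ
  have hπ : (Real.pi : ℂ) ≠ 0 := by exact_mod_cast Real.pi_ne_zero
  have h1 := congrFun hD τ
  have hden : denom (ModularGroup.S : SL(2, ℤ)) τ = (τ : ℂ) := by
    simp [denom, ModularGroup.coe_S]
  simp only [Pi.sub_apply, Pi.add_apply, ModularGroup.coe_S, hden] at h1
  have h2 : (D E2 ∣[(2 : ℤ) + 2] ModularGroup.S) τ =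
      D E2 (ModularGroup.S • τ) * ((τ : ℂ) ^ 4)⁻¹ := by
    rw [slash_S_apply]; norm_num
  have h10 : ((!![0, -1; 1, 0] : Matrix (Fin 2) (Fin 2) ℤ) 1 0) = 1 := rfl
  rw [h2, h10] at h1
  rw [slash_S_apply]
  simp only [Derivative.serreDerivative, E2_S]
  rw [show (τ : ℂ) ^ (-(2 + 2) : ℤ) = ((τ : ℂ) ^ 4)⁻¹ by norm_num]
  generalize D E2 (ModularGroup.S • τ) = X at h1 ⊢
  have ha : (2 * Real.pi * I : ℂ)⁻¹ = (Real.pi * I)⁻¹ / 2 := by rw [mul_assoc, mul_inv]; ring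
  rw [ha] at h1
  rw [div_eq_mul_inv (6 : ℂ)] at h1
  rw [div_eq_mul_inv (6 * (τ : ℂ))]
  generalize ((Real.pi : ℂ) * I)⁻¹ = a at h1 ⊢
  push_cast at h1
  field_simp at h1 ⊢
  linear_combination -6 * h1

lemma HasJet.isBigO_three {f : ℍ → ℂ} (hf : HasJet f 0 0 0) :
    f =O[atImInfty] fun τ : ℍ ↦ Real.exp (-(2 * Real.pi * (3 : ℕ)) * τ.im) := by
  simpa using hf.isBigO

lemma HasJet.serreDerivative {f : ℍ → ℂ} {a₀ a₁ a₂ : ℂ} (hf : HasJet f a₀ a₁ a₂) (k : ℂ) :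
    HasJet (Derivative.serreDerivative k f) (0 - k * 12⁻¹ * (1 * a₀))
      (a₁ - k * 12⁻¹ * (1 * a₁ + -24 * a₀))
      (2 * a₂ - k * 12⁻¹ * (1 * a₂ + -24 * a₁ + -72 * a₀)) := by
  convert hf.normalizedDeriv.sub ((hasJet_E2.mul hf).smul (k * 12⁻¹)) using 1
  ext τ
  simp [Derivative.serreDerivative]
  ring

lemma isLevelThreePair_serreDerivative_one_E2 :
    IsLevelThreePair (2 + 2) (Derivative.serreDerivative 1 E2)
      (Derivative.serreDerivative 1 E2) where
  mdiff := (hasJet_E2.serreDerivative 1).mdiff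
  mdiff' := (hasJet_E2.serreDerivative 1).mdiff
  bdd := (hasJet_E2.serreDerivative 1).isBoundedAtImInfty
  bdd' := (hasJet_E2.serreDerivative 1).isBoundedAtImInfty
  slash_T := serreDerivative_one_E2_slash_T
  slash_S := serreDerivative_one_E2_slash_S
  slash_T_pow := by
    rw [show ModularGroup.T ^ 3 = ModularGroup.T * ModularGroup.T * ModularGroup.T from
        pow_three' _,
      SlashAction.slash_mul, SlashAction.slash_mul]
    simp only [serreDerivative_one_E2_slash_T]

/-- A weight four modular form for `Γ₀(3)` vanishing at `i∞`. -/
noncomputable def cuspThree : ℍ → ℂ :=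
  (1 / 4 : ℂ) • ((6 : ℂ) • Derivative.serreDerivative ((2 : ℤ) : ℂ) E2Three + E2Three * E2Three)

lemma hasJet_cuspThree : HasJet cuspThree 0 27 243 := by
  rw [cuspThree]
  convert (((hasJet_E2Three.serreDerivative (2 : ℤ)).smul 6).add
    (hasJet_E2Three.mul hasJet_E2Three)).smul (1 / 4) using 1 <;> norm_num

lemma serreDerivative_one_E2_add :
    Derivative.serreDerivative 1 E2 + ((1 / 4 : ℂ) • (E2Three * E2Three) +
      Derivative.serreDerivative ((2 : ℤ) : ℂ) E2Three) = 0 := by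
  have hP := isLevelThreePair_E2Three
  refine (isLevelThreePair_serreDerivative_one_E2.add
    (((hP.mul hP).smul (1 / 4)).add hP.serreDerivative)).eq_zero (by decide) 2 (by decide) ?_
  refine HasJet.isBigO_two (a₂ := 0) ?_
  convert (hasJet_E2.serreDerivative 1).add (((hasJet_E2Three.mul hasJet_E2Three).smul
    (1 / 4)).add (hasJet_E2Three.serreDerivative (2 : ℤ))) using 1 <;> norm_num

lemma isLevelThreePair_cuspThree : ∃ g, IsLevelThreePair (2 + 2) cuspThree g :=
  ⟨_, ((isLevelThreePair_E2Three.serreDerivative.smul 6).add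
    (isLevelThreePair_E2Three.mul isLevelThreePair_E2Three)).smul (1 / 4)⟩

lemma serreDerivative_cuspThree :
    E2Three * Derivative.serreDerivative ((2 + 2 : ℤ) : ℂ) cuspThree +
      ((-2 : ℂ) • (Derivative.serreDerivative ((2 : ℤ) : ℂ) E2Three * cuspThree) +
      ((1 : ℂ) • (cuspThree * cuspThree) + (-1 : ℂ) • (E2Three * E2Three * cuspThree))) = 0 := by
  have hP := isLevelThreePair_E2Three
  obtain ⟨g, hy⟩ := isLevelThreePair_cuspThree
  have hyJ := hasJet_cuspThree
  have hPJ := hasJet_E2Three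
  have h1 := (hP.mul hy.serreDerivative)
  have h2 := (hP.serreDerivative.mul hy).smul (-2)
  have h3 := (hy.mul hy).smul 1
  have h4 := ((hP.mul hP).mul hy).smul (-1)
  refine (h1.add (h2.add (h3.add h4))).eq_zero (by decide) 3 (by decide) ?_
  refine HasJet.isBigO_three ?_
  convert (hPJ.mul (hyJ.serreDerivative (2 + 2 : ℤ))).add
    ((((hPJ.serreDerivative (2 : ℤ)).mul hyJ).smul (-2)).add
    (((hyJ.mul hyJ).smul 1).add (((hPJ.mul hPJ).mul hyJ).smul (-1)))) using 1 <;> norm_num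

/-- Coefficients of the hypergeometric series `₂F₁(1/6, 1/3; 1; z)`. -/
noncomputable def hyperCoeff (n : ℕ) : ℂ :=
  ((ascPochhammer ℂ n).eval (1 / 6) * (ascPochhammer ℂ n).eval (1 / 3)) /
    ((ascPochhammer ℂ n).eval 1 * (n.factorial : ℂ))

/-- The image of `₂F₁(1/6, 1/3; 1; z)` under the `k`-th power of the operator `z d/dz`. -/
noncomputable def hyperSum (k : ℕ) (z : ℂ) : ℂ := ∑' n : ℕ, (n : ℂ) ^ k * hyperCoeff n * z ^ n

lemma hyp2F1_eq_hyperSum (z : ℂ) : hyp2F1 (1 / 6) (1 / 3) 1 z = hyperSum 0 z := by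
  simp [hyp2F1, hyperSum, hyperCoeff]

lemma hyperCoeff_zero : hyperCoeff 0 = 1 := by simp [hyperCoeff]

lemma hyperCoeff_succ (n : ℕ) :
    ((n : ℂ) + 1) ^ 2 * hyperCoeff (n + 1) = (n + 1 / 6) * (n + 1 / 3) * hyperCoeff n := by
  have h : (n.factorial : ℂ) ≠ 0 := by exact_mod_cast n.factorial_ne_zero
  have h' : (n + 1 : ℂ) ≠ 0 := by exact_mod_cast n.succ_ne_zero
  have h'' : (1 + n : ℂ) ≠ 0 := by rwa [add_comm]
  simp only [hyperCoeff, ascPochhammer_succ_eval, ascPochhammer_eval_one, Nat.factorial_succ]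
  push_cast
  field_simp
  ring

lemma norm_hyperCoeff_le (n : ℕ) : ‖hyperCoeff n‖ ≤ 1 := by
  induction n with
  | zero => simp [hyperCoeff_zero]
  | succ n ih =>
    have h := congrArg norm (hyperCoeff_succ n)
    have h1 : ‖(n + 1 : ℂ)‖ = n + 1 := by exact_mod_cast Complex.norm_natCast (n + 1)
    have h2 : ‖(n + 1 / 6 : ℂ)‖ ≤ n + 1 :=
      (norm_add_le _ _).trans (by rw [Complex.norm_natCast]; norm_num)
    have h3 : ‖(n + 1 / 3 : ℂ)‖ ≤ n + 1 :=
      (norm_add_le _ _).trans (by rw [Complex.norm_natCast]; norm_num)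
    rw [norm_mul, norm_mul, norm_mul, norm_pow, h1] at h
    have h4 : ‖(n + 1 / 6 : ℂ)‖ * ‖(n + 1 / 3 : ℂ)‖ * ‖hyperCoeff n‖ ≤ (n + 1) * (n + 1) * 1 := by
      gcongr
    have h5 : (0 : ℝ) < (n + 1) ^ 2 := by positivity
    nlinarith

lemma norm_hyperSum_term_le (k n : ℕ) (z : ℂ) :
    ‖(n : ℂ) ^ k * hyperCoeff n * z ^ n‖ ≤ (n : ℝ) ^ k * ‖z‖ ^ n := by
  rw [norm_mul, norm_mul, norm_pow, norm_pow, Complex.norm_natCast]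
  have := norm_hyperCoeff_le n
  gcongr
  exact mul_le_of_le_one_right (by positivity) this

lemma summable_hyperSum (k : ℕ) {z : ℂ} (hz : ‖z‖ < 1) :
    Summable fun n : ℕ ↦ (n : ℂ) ^ k * hyperCoeff n * z ^ n :=
  .of_norm_bounded (summable_pow_mul_geometric_of_norm_lt_one k (by simpa using hz))
    fun n ↦ norm_hyperSum_term_le k n z

lemma hyperSum_apply_zero (k : ℕ) : hyperSum k 0 = (0 : ℂ) ^ k := by
  rw [hyperSum, tsum_eq_single 0 fun n hn ↦ by simp [hn]]
  simp [hyperCoeff_zero]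

lemma exists_hasDerivAt_hyperSum (k : ℕ) {z : ℂ} (hz : ‖z‖ < 1) :
    ∃ d, HasDerivAt (hyperSum k) d z ∧ z * d = hyperSum (k + 1) z := by
  obtain ⟨r, hzr, hr⟩ := exists_between hz
  have hr0 : 0 < r := (norm_nonneg z).trans_lt hzr
  refine ⟨∑' n : ℕ, (n : ℂ) ^ k * hyperCoeff n * (n * z ^ (n - 1)), ?_, ?_⟩
  · have hu : Summable fun n : ℕ ↦ r⁻¹ * ((n : ℝ) ^ (k + 1) * r ^ n) :=
      have hr' : ‖r‖ < 1 := by rwa [Real.norm_of_nonneg hr0.le]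
      (summable_pow_mul_geometric_of_norm_lt_one (k + 1) hr').mul_left r⁻¹
    have hd (n : ℕ) (w : ℂ) (_ : w ∈ Metric.ball (0 : ℂ) r) :
        HasDerivAt (fun w ↦ (n : ℂ) ^ k * hyperCoeff n * w ^ n)
          ((n : ℂ) ^ k * hyperCoeff n * (n * w ^ (n - 1))) w :=
      (hasDerivAt_pow n w).const_mul _
    have hb (n : ℕ) (w : ℂ) (hw : w ∈ Metric.ball (0 : ℂ) r) :
        ‖(n : ℂ) ^ k * hyperCoeff n * (n * w ^ (n - 1))‖ ≤ r⁻¹ * ((n : ℝ) ^ (k + 1) * r ^ n) := by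
      rcases n with _ | n
      · simp
      have hw : ‖w‖ ≤ r := (mem_ball_zero_iff.mp hw).le
      have hc := norm_hyperCoeff_le (n + 1)
      rw [norm_mul, norm_mul, norm_mul, norm_pow, norm_pow, Complex.norm_natCast]
      calc ((n + 1 : ℕ) : ℝ) ^ k * ‖hyperCoeff (n + 1)‖ * (((n + 1 : ℕ) : ℝ) * ‖w‖ ^ n)
          ≤ ((n + 1 : ℕ) : ℝ) ^ k * 1 * (((n + 1 : ℕ) : ℝ) * r ^ n) := by gcongr
        _ = _ := by field_simp; ring
    exact hasDerivAt_tsum_of_isPreconnected hu Metric.isOpen_ball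
      (convex_ball (0 : ℂ) r).isPreconnected hd hb (Metric.mem_ball_self hr0)
      (summable_hyperSum k (by simp)) (mem_ball_zero_iff.mpr hzr)
  · rw [hyperSum, ← tsum_mul_left]
    refine tsum_congr fun n ↦ ?_
    rcases n with _ | n
    · simp
    · simp only [Nat.add_sub_cancel]
      ring

lemma hyperSum_ode {z : ℂ} (hz : ‖z‖ < 1) :
    (1 - z) * hyperSum 2 z = z * (hyperSum 1 z / 2 + hyperSum 0 z / 18) := by
  have h : hyperSum 2 z = z * (hyperSum 2 z + hyperSum 1 z / 2 + hyperSum 0 z / 18) := by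
    conv_lhs => rw [hyperSum, (summable_hyperSum 2 hz).tsum_eq_zero_add]
    have h2 := (summable_hyperSum 2 hz).hasSum
    have h1 := (summable_hyperSum 1 hz).hasSum.div_const 2
    have h0 := (summable_hyperSum 0 hz).hasSum.div_const 18
    rw [hyperSum, hyperSum, hyperSum, ← ((h2.add h1).add h0).tsum_eq, ← tsum_mul_left]
    simp only [CharP.cast_eq_zero, ne_eq, OfNat.ofNat_ne_zero, not_false_eq_true, zero_pow,
      zero_mul, zero_add]
    refine tsum_congr fun n ↦ ?_
    push_cast
    rw [hyperCoeff_succ]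
    ring
  linear_combination h

instance neBot_comap_im_atTop : (comap Complex.im atTop).NeBot :=
  comap_neBot fun _ ht ↦
    let ⟨a, ha⟩ := (nonempty_of_mem ht)
    ⟨⟨0, a⟩, ha⟩

lemma eventually_lt_im (Y : ℝ) : ∀ᶠ z in comap Complex.im atTop, Y < z.im :=
  tendsto_comap.eventually_gt_atTop Y

/-- A function with zero derivative on a half-plane is equal to its limit at `i∞`. -/
lemma eq_of_hasDerivAt_zero {f : ℂ → ℂ} {Y : ℝ} {c : ℂ}
    (hf : ∀ z : ℂ, Y < z.im → HasDerivAt f 0 z) (hc : Tendsto f (comap Complex.im atTop) (𝓝 c))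
    {z : ℂ} (hz : Y < z.im) : f z = c := by
  refine tendsto_nhds_unique_of_eventuallyEq tendsto_const_nhds hc ?_
  filter_upwards [eventually_lt_im Y] with w hw
  exact (isOpen_lt continuous_const Complex.continuous_im).is_const_of_deriv_eq_zero
    (convex_halfSpace_im_gt Y).isPreconnected
    (fun w hw ↦ (hf w hw).differentiableAt.differentiableWithinAt) (fun w hw ↦ (hf w hw).deriv)
    hz hw

/-- The solution at `i∞` of the Ramanujan type system of level three is parametrised by the square
of a hypergeometric function. -/
lemma eq_hyperSum_sq_of_hasDerivAt {P A x : ℂ → ℂ} {κ : ℂ} {Y : ℝ}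
    (hP : ∀ z : ℂ, Y < z.im → HasDerivAt P (κ * (P z * (A z - P z + 4 * P z * x z) / 6)) z)
    (hA : ∀ z : ℂ, Y < z.im → HasDerivAt A (κ * ((A z ^ 2 - P z ^ 2 * (1 + 8 * x z)) / 12)) z)
    (hx : ∀ z : ℂ, Y < z.im → HasDerivAt x (κ * (x z * (1 - x z) * P z)) z)
    (hP0 : ∀ z : ℂ, Y < z.im → P z ≠ 0)
    (hx1 : ∀ z : ℂ, Y < z.im → ‖4 * x z * (1 - x z)‖ < 1)
    (hPlim : Tendsto P (comap Complex.im atTop) (𝓝 1))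
    (hAlim : Tendsto A (comap Complex.im atTop) (𝓝 1))
    (hxlim : Tendsto x (comap Complex.im atTop) (𝓝 0)) {z : ℂ} (hz : Y < z.im) :
    P z = hyperSum 0 (4 * x z * (1 - x z)) ^ 2 := by
  set F : ℕ → ℂ → ℂ := fun k z ↦ hyperSum k (4 * x z * (1 - x z)) with hF
  have hF' (k : ℕ) (z : ℂ) (hz : Y < z.im) :
      HasDerivAt (F k) (κ * ((1 - 2 * x z) * P z * F (k + 1) z)) z := by
    obtain ⟨d, hd, hd'⟩ := exists_hasDerivAt_hyperSum k (hx1 z hz)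
    have h4 := ((hx z hz).const_mul 4).mul ((hx z hz).const_sub 1)
    refine (hd.comp z h4).congr_deriv ?_
    simp only [hF, ← hd']
    ring
  have hFlim (k : ℕ) : Tendsto (F k) (comap Complex.im atTop) (𝓝 ((0 : ℂ) ^ k)) := by
    obtain ⟨d, hd, -⟩ := exists_hasDerivAt_hyperSum k (z := 0) (by simp)
    have h := hd.continuousAt.tendsto
    rw [hyperSum_apply_zero] at h
    refine h.comp ?_
    simpa using (hxlim.const_mul 4).mul (hxlim.const_sub 1)
  have hode (z : ℂ) (hz : Y < z.im) : (1 - 2 * x z) ^ 2 * F 2 z =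
      4 * x z * (1 - x z) * (F 1 z / 2 + F 0 z / 18) := by
    rw [← hyperSum_ode (hx1 z hz)]
    ring
  set M : ℂ → ℂ := fun z ↦ (1 - 2 * x z) * P z * F 1 z -
    F 0 z * (A z - P z + 4 * P z * x z) / 12 with hM
  have hM' (z : ℂ) (hz : Y < z.im) :
      HasDerivAt M (κ * (M z * (A z - P z + 4 * P z * x z) / 12)) z := by
    have h1 := ((((hx z hz).const_mul 2).const_sub 1).mul (hP z hz)).mul (hF' 1 z hz)
    have h2 := (hF' 0 z hz).mul
      (((hA z hz).sub (hP z hz)).add (((hP z hz).const_mul 4).mul (hx z hz)))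
    refine (h1.sub (h2.div_const 12)).congr_deriv ?_
    simp only [hM, Pi.mul_apply, Pi.sub_apply, Pi.add_apply]
    linear_combination κ * P z ^ 2 * hode z hz
  have hMlim : Tendsto M (comap Complex.im atTop) (𝓝 0) := by
    have h1 := (((hxlim.const_mul 2).const_sub 1).mul hPlim).mul (hFlim 1)
    have h2 := ((hFlim 0).mul ((hAlim.sub hPlim).add ((hPlim.const_mul 4).mul hxlim))).div_const 12
    simpa using h1.sub h2
  have hM0 (z : ℂ) (hz : Y < z.im) : M z = 0 := by
    have h := eq_of_hasDerivAt_zero (f := M ^ 2 / P) (c := 0) (fun z hz ↦ ?_) ?_ hz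
    · simpa [hP0 z hz] using h
    · refine (((hM' z hz).pow 2).div (hP z hz) (hP0 z hz)).congr_deriv ?_
      have := hP0 z hz
      simp only [Pi.pow_apply]
      field_simp
      ring
    · have hlim := (hMlim.pow 2).div hPlim one_ne_zero
      rwa [show (0 : ℂ) ^ 2 / 1 = 0 by norm_num] at hlim
  have h := eq_of_hasDerivAt_zero (f := F 0 ^ 2 / P) (c := 1) (fun z hz ↦ ?_) ?_ hz
  · exact ((div_eq_one_iff_eq (hP0 z hz)).mp h).symm
  · refine (((hF' 0 z hz).pow 2).div (hP z hz) (hP0 z hz)).congr_deriv ?_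
    have := hP0 z hz
    have hMz := hM0 z hz
    simp only [hM] at hMz
    simp only [Pi.pow_apply]
    field_simp
    simp only [zero_add]
    push_cast
    linear_combination 12 * κ * F 0 z * hMz
  · have hlim := ((hFlim 0).pow 2).div hPlim one_ne_zero
    rwa [show ((0 : ℂ) ^ 0) ^ 2 / 1 = 1 by norm_num] at hlim

lemma Eis2_eq_E2 {z : ℂ} (hz : 0 < z.im) : Eis2 z = E2 (ofComplex z) := by
  have hq : ‖qpar z‖ < 1 := by
    rw [norm_qpar, Real.exp_lt_one_iff]
    nlinarith [mul_pos Real.pi_pos hz]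
  have h : qpar z = cexp (2 * Real.pi * I * ((⟨z, hz⟩ : ℍ) : ℂ)) := rfl
  rw [ofComplex_apply_of_im_pos hz, E2_eq_tsum_cexp, ← h,
    ← tsum_pow_div_one_sub_eq_tsum_sigma hq 1, Eis2,
    tsum_pnat_eq_tsum_succ (f := fun n : ℕ ↦ (n : ℂ) ^ 1 * qpar z ^ n / (1 - qpar z ^ n))]
  simp

lemma dedekindEta_eq_eta (z : ℂ) : dedekindEta z = ModularForm.eta z := by
  simp only [dedekindEta, ModularForm.eta, ModularForm.eta_q_eq_pow, Function.Periodic.qParam, qpar]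
  push_cast
  rfl

lemma hasDerivAt_dedekindEta {z : ℂ} (hz : 0 < z.im) :
    HasDerivAt dedekindEta (Real.pi * I / 12 * E2 (ofComplex z) * dedekindEta z) z := by
  have h := ModularForm.logDeriv_eta_eq_E2 ⟨z, hz⟩
  have h0 := ModularForm.eta_ne_zero hz
  have hd := (ModularForm.differentiableAt_eta_of_mem_upperHalfPlaneSet hz).hasDerivAt
  rw [logDeriv_apply, div_eq_iff h0] at h
  rw [funext dedekindEta_eq_eta, ofComplex_apply_of_im_pos hz, ← h]
  exact hd

lemma dedekindEta_ne_zero {z : ℂ} (hz : 0 < z.im) : dedekindEta z ≠ 0 :=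
  dedekindEta_eq_eta z ▸ ModularForm.eta_ne_zero hz

/-- The eta quotient `27 η(3τ)¹² / η(τ)¹²`. -/
noncomputable def etaQuotient (z : ℂ) : ℂ := 27 * dedekindEta (3 * z) ^ 12 / dedekindEta z ^ 12

lemma etaQuotient_ne_zero {z : ℂ} (hz : 0 < z.im) : etaQuotient z ≠ 0 := by
  have h1 := dedekindEta_ne_zero hz
  have h2 := dedekindEta_ne_zero (z := 3 * z) (by simpa using hz)
  simp [etaQuotient, h1, h2]

lemma hasDerivAt_etaQuotient {z : ℂ} (hz : 0 < z.im) :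
    HasDerivAt etaQuotient (2 * Real.pi * I * (E2Three (ofComplex z) * etaQuotient z)) z := by
  have hz3 : 0 < (3 * z).im := by simpa using hz
  have h1 := dedekindEta_ne_zero hz
  have h2 := (hasDerivAt_dedekindEta hz3).comp z ((hasDerivAt_id z).const_mul 3)
  refine (((h2.pow 12).const_mul 27).div ((hasDerivAt_dedekindEta hz).pow 12)
    (pow_ne_zero 12 h1)).congr_deriv ?_
  simp only [etaQuotient, E2Three, scaleArg, Pi.sub_apply, Pi.smul_apply, Function.comp_apply,
    smul_eq_mul, ofComplex_apply_of_im_pos hz, Pi.pow_apply]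
  push_cast
  field_simp

lemma tendsto_qpar_comap_im : Tendsto qpar (comap Complex.im atTop) (𝓝 0) := by
  refine (tendsto_qpar.comp tendsto_comap_im_ofComplex).congr' ?_
  filter_upwards [eventually_lt_im 0] with z hz
  simp [ofComplex_apply_of_im_pos hz]

lemma tendsto_etaQuotient_div_qpar :
    Tendsto (fun z ↦ etaQuotient z / qpar z) (comap Complex.im atTop) (𝓝 27) := by
  set p : ℂ → ℂ := fun q ↦ ∏' n : ℕ, (1 - q ^ (n + 1)) with hp
  have hpc : Tendsto p (𝓝 0) (𝓝 1) := by
    have h := (ModularForm.differentiableOn_tprod_one_sub_pow.differentiableAt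
      (Metric.ball_mem_nhds 0 one_pos)).continuousAt.tendsto
    simpa using h
  have hq (z : ℂ) : qpar (3 * z) = qpar z ^ 3 := by
    rw [qpar, qpar, ← Complex.exp_nat_mul]
    congr 1
    push_cast
    ring
  have h1 := hpc.comp tendsto_qpar_comap_im
  have h3 : Tendsto (fun z ↦ p (qpar (3 * z))) (comap Complex.im atTop) (𝓝 1) := by
    refine hpc.comp ?_
    simpa [hq] using tendsto_qpar_comap_im.pow 3
  have h := ((h3.pow 12).div (h1.pow 12) (by simp)).const_mul 27
  simp only [one_pow, div_one, mul_one] at h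
  refine h.congr' ?_
  filter_upwards [eventually_lt_im 0] with z hz
  have he : cexp (2 * Real.pi * I * (3 * z) / 24) ^ 12 =
      cexp (2 * Real.pi * I * z / 24) ^ 12 * qpar z := by
    rw [qpar, ← Complex.exp_nat_mul, ← Complex.exp_nat_mul, ← Complex.exp_add]
    congr 1
    push_cast
    ring
  have h0 : p (qpar z) ≠ 0 := fun h0 ↦ dedekindEta_ne_zero hz (by
    rw [dedekindEta]
    exact mul_eq_zero_of_right _ h0)
  have hz0 := qpar_ne_zero z
  have he0 := Complex.exp_ne_zero (2 * Real.pi * I * z / 24)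
  change 27 * (p (qpar (3 * z)) ^ 12 / p (qpar z) ^ 12) =
    27 * (cexp (2 * Real.pi * I * (3 * z) / 24) * p (qpar (3 * z))) ^ 12 /
      (cexp (2 * Real.pi * I * z / 24) * p (qpar z)) ^ 12 / qpar z
  rw [mul_pow, he]
  field_simp

lemma hasDerivAt_comp_ofComplex {f : ℍ → ℂ} (hf : MDiff f) {z : ℂ} (hz : 0 < z.im) :
    HasDerivAt (fun z ↦ f (ofComplex z)) (2 * Real.pi * I * D f (ofComplex z)) z := by
  have h := (mdifferentiableAt_iff.mp (hf ⟨z, hz⟩)).hasDerivAt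
  rw [Derivative.normalizedDerivOfComplex, mul_inv_cancel_left₀ two_pi_I_ne_zero,
    ofComplex_apply_of_im_pos hz]
  exact h

lemma normalizedDeriv_E2Three (τ : ℍ) :
    D E2Three τ = (E2 τ * E2Three τ + 4 * cuspThree τ - E2Three τ ^ 2) / 6 := by
  simp only [cuspThree, Derivative.serreDerivative, Pi.add_apply, Pi.smul_apply, Pi.mul_apply,
    smul_eq_mul]
  push_cast
  ring

lemma normalizedDeriv_E2 (τ : ℍ) :
    D E2 τ = (E2 τ ^ 2 - E2Three τ ^ 2 - 8 * cuspThree τ) / 12 := by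
  have h := congrFun serreDerivative_one_E2_add τ
  have h2 := normalizedDeriv_E2Three τ
  simp only [Derivative.serreDerivative, Pi.add_apply, Pi.smul_apply, Pi.mul_apply,
    smul_eq_mul, Pi.zero_apply] at h
  push_cast at h
  linear_combination h - h2

lemma normalizedDeriv_cuspThree (τ : ℍ) :
    E2Three τ * D cuspThree τ = cuspThree τ * (E2 τ * E2Three τ + cuspThree τ +
      2 * E2Three τ ^ 2) / 3 := by
  have h := congrFun serreDerivative_cuspThree τ
  have h2 := normalizedDeriv_E2Three τ
  simp only [Derivative.serreDerivative, Pi.add_apply, Pi.smul_apply, Pi.mul_apply,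
    smul_eq_mul, Pi.zero_apply] at h
  push_cast at h
  linear_combination h + 2 * cuspThree τ * h2

lemma cuspThree_eq {Y : ℝ} (hY : 0 ≤ Y)
    (hy : ∀ z : ℂ, Y < z.im → E2Three (ofComplex z) ^ 2 - cuspThree (ofComplex z) ≠ 0) {z : ℂ}
    (hz : Y < z.im) :
    cuspThree (ofComplex z) =
      etaQuotient z * (E2Three (ofComplex z) ^ 2 - cuspThree (ofComplex z)) := by
  have hu (w : ℂ) (hw : Y < w.im) := etaQuotient_ne_zero (hY.trans_lt hw)
  have h : cuspThree (ofComplex z) /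
      (etaQuotient z * (E2Three (ofComplex z) ^ 2 - cuspThree (ofComplex z))) = 1 := by
    refine eq_of_hasDerivAt_zero (f := fun z ↦ cuspThree (ofComplex z) /
      (etaQuotient z * (E2Three (ofComplex z) ^ 2 - cuspThree (ofComplex z))))
      (fun w hw ↦ ?_) ?_ hz
    · have hw0 := hY.trans_lt hw
      have hyd := hasDerivAt_comp_ofComplex hasJet_cuspThree.mdiff hw0
      have hPd := hasDerivAt_comp_ofComplex hasJet_E2Three.mdiff hw0
      have hd := hyd.div ((hasDerivAt_etaQuotient hw0).mul ((hPd.pow 2).sub hyd))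
        (mul_ne_zero (hu w hw) (hy w hw))
      refine hd.congr_deriv ?_
      have h1 := normalizedDeriv_cuspThree (ofComplex w)
      have h2 := normalizedDeriv_E2Three (ofComplex w)
      rw [div_eq_zero_iff]
      left
      simp only [Pi.mul_apply, Pi.sub_apply, Pi.pow_apply]
      push_cast
      linear_combination 2 * Real.pi * I * etaQuotient w * (E2Three (ofComplex w) * h1 -
        2 * cuspThree (ofComplex w) * E2Three (ofComplex w) * h2)
    · have hyt := hasJet_cuspThree.tendsto.comp tendsto_comap_im_ofComplex
      have hyq := hasJet_cuspThree.tendsto_div_qpar.comp tendsto_comap_im_ofComplex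
      have hPt := hasJet_E2Three.tendsto.comp tendsto_comap_im_ofComplex
      have ht := hyq.div (tendsto_etaQuotient_div_qpar.mul ((hPt.pow 2).sub hyt)) (by norm_num)
      rw [show (27 : ℂ) / (27 * (1 ^ 2 - 0)) = 1 by norm_num] at ht
      refine ht.congr' ?_
      filter_upwards [eventually_lt_im 0] with w hw
      have hq := qpar_ne_zero w
      simp only [Pi.div_apply, Function.comp_apply, ofComplex_apply_of_im_pos hw]
      change cuspThree ⟨w, hw⟩ / qpar w / _ = _
      field_simp
  rwa [div_eq_one_iff_eq (mul_ne_zero (hu z hz) (hy z hz))] at h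

/-- The rational parametrisation `y / P²` of the modular curve `X₀(3)`. -/
noncomputable def hauptmodul (z : ℂ) : ℂ := cuspThree (ofComplex z) / E2Three (ofComplex z) ^ 2

lemma tendsto_hauptmodul : Tendsto hauptmodul (comap Complex.im atTop) (𝓝 0) := by
  have h := (hasJet_cuspThree.tendsto.comp tendsto_comap_im_ofComplex).div
    ((hasJet_E2Three.tendsto.comp tendsto_comap_im_ofComplex).pow 2) (by simp)
  rwa [zero_div] at h

lemma hasDerivAt_hauptmodul {z : ℂ} (hz : 0 < z.im) (hP : E2Three (ofComplex z) ≠ 0) :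
    HasDerivAt hauptmodul (2 * Real.pi * I *
      (hauptmodul z * (1 - hauptmodul z) * E2Three (ofComplex z))) z := by
  have hyd := hasDerivAt_comp_ofComplex hasJet_cuspThree.mdiff hz
  have hPd := hasDerivAt_comp_ofComplex hasJet_E2Three.mdiff hz
  refine (hyd.div (hPd.pow 2) (pow_ne_zero 2 hP)).congr_deriv ?_
  have h1 := normalizedDeriv_cuspThree (ofComplex z)
  have h2 := normalizedDeriv_E2Three (ofComplex z)
  simp only [hauptmodul, Pi.pow_apply]
  push_cast
  field_simp
  linear_combination h1 - 2 * cuspThree (ofComplex z) * h2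

lemma exists_forall_E2Three_eq_hyperSum_sq : ∃ Y : ℝ, 0 < Y ∧ ∀ z : ℂ, Y < z.im →
    E2Three (ofComplex z) = hyperSum 0 (4 * etaQuotient z / (1 + etaQuotient z) ^ 2) ^ 2 := by
  have hPt := hasJet_E2Three.tendsto.comp tendsto_comap_im_ofComplex
  have hyt := hasJet_cuspThree.tendsto.comp tendsto_comap_im_ofComplex
  have hAt := hasJet_E2.tendsto.comp tendsto_comap_im_ofComplex
  have hev1 := hPt.eventually_ne one_ne_zero
  have hev2 := ((hPt.pow 2).sub hyt).eventually_ne (by norm_num : (1 : ℂ) ^ 2 - 0 ≠ 0)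
  have hxt := (tendsto_hauptmodul.const_mul 4).mul (tendsto_hauptmodul.const_sub 1)
  have hev3 := hxt.norm.eventually_lt_const (by simp : ‖(4 * 0 * (1 - 0) : ℂ)‖ < 1)
  obtain ⟨Y, hY⟩ := eventually_atTop.mp
    (eventually_comap.mp (hev1.and (hev2.and hev3)))
  set Y' := max Y 1
  have hY' (z : ℂ) (hz : Y' < z.im) := hY z.im ((le_max_left _ _).trans hz.le) z rfl
  have hY0 : 0 < Y' := one_pos.trans_le (le_max_right _ _)
  have hP (z : ℂ) (hz : Y' < z.im) : E2Three (ofComplex z) ≠ 0 := (hY' z hz).1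
  refine ⟨Y', hY0, fun z hz ↦ ?_⟩
  have hPz := hP z hz
  have hu := cuspThree_eq hY0.le (fun w hw ↦ (hY' w hw).2.1) hz
  have hu1 : 1 + etaQuotient z ≠ 0 := fun h ↦ pow_ne_zero 2 hPz (by
    linear_combination hu + (E2Three (ofComplex z) ^ 2 - cuspThree (ofComplex z)) * h)
  have hx : hauptmodul z = etaQuotient z / (1 + etaQuotient z) := by
    rw [hauptmodul, div_eq_div_iff (pow_ne_zero 2 hPz) hu1]
    linear_combination hu
  have harg : 4 * etaQuotient z / (1 + etaQuotient z) ^ 2 =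
      4 * hauptmodul z * (1 - hauptmodul z) := by
    rw [hx]
    field_simp
    ring
  rw [harg]
  refine eq_hyperSum_sq_of_hasDerivAt (P := fun z ↦ E2Three (ofComplex z))
    (A := fun z ↦ E2 (ofComplex z)) (κ := 2 * Real.pi * I) (fun w hw ↦ ?_) (fun w hw ↦ ?_)
    (fun w hw ↦ hasDerivAt_hauptmodul (hY0.trans hw) (hP w hw)) hP
    (fun w hw ↦ (hY' w hw).2.2) hPt hAt tendsto_hauptmodul hz
  · have hPw := hP w hw
    refine (hasDerivAt_comp_ofComplex hasJet_E2Three.mdiff (hY0.trans hw)).congr_deriv ?_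
    rw [normalizedDeriv_E2Three, hauptmodul]
    field_simp
    ring
  · have hPw := hP w hw
    refine (hasDerivAt_comp_ofComplex hasJet_E2.mdiff (hY0.trans hw)).congr_deriv ?_
    rw [normalizedDeriv_E2, hauptmodul]
    field_simp
    ring

lemma E2Three_ofComplex {z : ℂ} (hz : 0 < z.im) :
    E2Three (ofComplex z) = (3 * Eis2 (3 * z) - Eis2 z) / 2 := by
  rw [Eis2_eq_E2 hz, Eis2_eq_E2 (z := 3 * z) (by simpa using hz)]
  simp only [E2Three, scaleArg, Pi.sub_apply, Pi.smul_apply, smul_eq_mul,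
    ofComplex_apply_of_im_pos hz]
  push_cast
  ring

end

/- STATEMENT 16: with `s = −27 η(3τ)¹²/η(τ)¹²`,
`(3E₂(3τ) − E₂(τ))/2 = ₂F₁(1/6,1/3;1;−4s/(1−s)²)²` for `Im τ` large. -/

theorem stmt16 :
    ∃ Y : ℝ, 0 < Y ∧ ∀ τ : ℂ, Y < τ.im →
      (3 * Eis2 (3 * τ) - Eis2 τ) / 2
        = (hyp2F1 (1/6) (1/3) 1
            (-4 * (-27 * dedekindEta (3 * τ) ^ 12 / dedekindEta τ ^ 12) /
              (1 - (-27 * dedekindEta (3 * τ) ^ 12 / dedekindEta τ ^ 12)) ^ 2)) ^ 2 := by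
  obtain ⟨Y, hY, h⟩ := exists_forall_E2Three_eq_hyperSum_sq
  refine ⟨Y, hY, fun τ hτ ↦ ?_⟩
  have hs : -27 * dedekindEta (3 * τ) ^ 12 / dedekindEta τ ^ 12 = -etaQuotient τ := by
    rw [etaQuotient]
    ring
  rw [← E2Three_ofComplex (hY.trans hτ), h τ hτ, hyp2F1_eq_hyperSum, hs]
  congr 3 <;> ring
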